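/- Let b ∈ ℝ^m and x† ∈ ℝⁿ satisfy A x† = b and x† ∈ N(A)^⊥. Let y₀ ∈ ℝⁿ be arbitrary, define the Kaczmarz–Tanabe iteration y_{k+1} = (I − A_SᵀMA) y_k + A_SᵀM b, and set e_k = y_k − P_{N(A)}y₀ − x†. Let 𝒦 = 1 − min({1 − σ² : σ is a singular value of Q with σ < 1} ∪ {1}). Then for every k ≥ 0, ‖e_{k+1}‖₂² ≤ 𝒦 ‖e_k‖₂² and ‖e_{k+1}‖₂² ≤ 𝒦^{k+1} ‖e₀‖₂². -/

import Mathlib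

open Matrix

noncomputable section

/-- The Euclidean norm on `Fin k → ℝ`. -/
def euclNorm {k : ℕ} (x : Fin k → ℝ) : ℝ := Real.sqrt (∑ i, x i ^ 2)

/-- The orthogonal projection `Pᵢ = I − aᵢaᵢᵀ/‖aᵢ‖₂²` onto the hyperplane `{x : aᵢᵀx = 0}`,
where `aᵢ` is the `i`-th row of `A`. -/
def projMat {m n : ℕ} (A : Matrix (Fin m) (Fin n) ℝ) (i : Fin m) :
    Matrix (Fin n) (Fin n) ℝ :=
  1 - (euclNorm (A i) ^ 2)⁻¹ • Matrix.vecMulVec (A i) (A i)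

/-- `Q = P_m P_{m−1} ⋯ P₁` (rows 0-indexed, so `Q = P_{m−1} ⋯ P₀`). -/
def Qmat {m n : ℕ} (A : Matrix (Fin m) (Fin n) ℝ) : Matrix (Fin n) (Fin n) ℝ :=
  ((List.finRange m).reverse.map (projMat A)).prod

/-- `Q_j = P_m P_{m−1} ⋯ P_{j+1}` (rows 0-indexed, so row `j` gets `P_{m−1} ⋯ P_{j+1}`);
in particular the last one is the identity. -/
def Qpart {m n : ℕ} (A : Matrix (Fin m) (Fin n) ℝ) (j : Fin m) : Matrix (Fin n) (Fin n) ℝ :=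
  (((List.finRange m).drop ((j : ℕ) + 1)).reverse.map (projMat A)).prod

/-- `A_S`: the `j`-th row is `Q_j a_j`. -/
def AS {m n : ℕ} (A : Matrix (Fin m) (Fin n) ℝ) : Matrix (Fin m) (Fin n) ℝ :=
  Matrix.of fun j => (Qpart A j).mulVec (A j)

/-- `M = diag(1/‖a₁‖₂², …, 1/‖a_m‖₂²)`. -/
def Mdiag {m n : ℕ} (A : Matrix (Fin m) (Fin n) ℝ) : Matrix (Fin m) (Fin m) ℝ :=
  Matrix.diagonal fun i => (euclNorm (A i) ^ 2)⁻¹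

/-- The spectral norm of a matrix: the operator norm of the induced linear map
between Euclidean spaces. -/
def spec {k l : ℕ} (B : Matrix (Fin k) (Fin l) ℝ) : ℝ :=
  ‖LinearMap.toContinuousLinearMap (Matrix.toEuclideanLin B)‖

/-- `σ` is a singular value of the square matrix `B`: `σ ≥ 0` and `σ²` is an
eigenvalue of `BᵀB`. -/
def IsSingularValue {k : ℕ} (B : Matrix (Fin k) (Fin k) ℝ) (σ : ℝ) : Prop :=
  0 ≤ σ ∧ ∃ x : Fin k → ℝ, x ≠ 0 ∧ (Bᵀ * B).mulVec x = (σ ^ 2) • x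

theorem real_dotProduct_self_nonneg {k : ℕ} (x : Fin k → ℝ) : 0 ≤ x ⬝ᵥ x :=
  Finset.sum_nonneg fun _ _ => mul_self_nonneg _

theorem euclNorm_sq {k : ℕ} (x : Fin k → ℝ) : euclNorm x ^ 2 = x ⬝ᵥ x := by
  rw [euclNorm, Real.sq_sqrt (Finset.sum_nonneg fun i _ => sq_nonneg _)]
  simp [dotProduct, sq]

theorem projMat_mulVec {m n : ℕ} (A : Matrix (Fin m) (Fin n) ℝ) (i : Fin m) (x : Fin n → ℝ) :
    projMat A i *ᵥ x = x - ((A i ⬝ᵥ A i)⁻¹ * (A i ⬝ᵥ x)) • A i := by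
  simp [projMat, euclNorm_sq, sub_mulVec, smul_mulVec, vecMulVec_mulVec, smul_smul]

theorem projMat_mulVec_of_dotProduct_eq_zero {m n : ℕ} {A : Matrix (Fin m) (Fin n) ℝ} {i : Fin m}
    {x : Fin n → ℝ} (hx : A i ⬝ᵥ x = 0) : projMat A i *ᵥ x = x := by
  simp [projMat_mulVec, hx]

theorem projMat_mulVec_dotProduct {m n : ℕ} {A : Matrix (Fin m) (Fin n) ℝ} {i : Fin m}
    {z : Fin n → ℝ} (hz : A i ⬝ᵥ z = 0) (x : Fin n → ℝ) :
    (projMat A i *ᵥ x) ⬝ᵥ z = x ⬝ᵥ z := by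
  simp [projMat_mulVec, sub_dotProduct, hz]

theorem projMat_mulVec_dotProduct_self {m n : ℕ} {A : Matrix (Fin m) (Fin n) ℝ} {i : Fin m}
    (hA : A i ≠ 0) (x : Fin n → ℝ) :
    (projMat A i *ᵥ x) ⬝ᵥ (projMat A i *ᵥ x) =
      x ⬝ᵥ x - (A i ⬝ᵥ A i)⁻¹ * (A i ⬝ᵥ x) ^ 2 := by
  have h : A i ⬝ᵥ A i ≠ 0 := by simpa using hA
  simp only [projMat_mulVec, sub_dotProduct, dotProduct_sub, smul_dotProduct, dotProduct_smul,
    smul_eq_mul, dotProduct_comm x (A i)]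
  field_simp
  ring

/-- The product of the projections indexed by `l`, the head of `l` being applied first. -/
def projProd {m n : ℕ} (A : Matrix (Fin m) (Fin n) ℝ) (l : List (Fin m)) :
    Matrix (Fin n) (Fin n) ℝ :=
  (l.reverse.map (projMat A)).prod

theorem projProd_nil {m n : ℕ} (A : Matrix (Fin m) (Fin n) ℝ) : projProd A [] = 1 := by
  simp [projProd]

theorem projProd_cons {m n : ℕ} (A : Matrix (Fin m) (Fin n) ℝ) (i : Fin m) (l : List (Fin m)) :
    projProd A (i :: l) = projProd A l * projMat A i := by
  simp [projProd]

theorem projProd_mulVec_dotProduct {m n : ℕ} {A : Matrix (Fin m) (Fin n) ℝ} {z : Fin n → ℝ}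
    (hz : ∀ i, A i ⬝ᵥ z = 0) (l : List (Fin m)) (x : Fin n → ℝ) :
    (projProd A l *ᵥ x) ⬝ᵥ z = x ⬝ᵥ z := by
  induction l generalizing x with
  | nil => simp [projProd_nil]
  | cons i l ih =>
    rw [projProd_cons, ← mulVec_mulVec, ih, projMat_mulVec_dotProduct (hz i)]

theorem projProd_mulVec_dotProduct_self_le {m n : ℕ} {A : Matrix (Fin m) (Fin n) ℝ}
    (hA : ∀ i, A i ≠ 0) (l : List (Fin m)) (x : Fin n → ℝ) :
    (projProd A l *ᵥ x) ⬝ᵥ (projProd A l *ᵥ x) ≤ x ⬝ᵥ x := by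
  induction l generalizing x with
  | nil => simp [projProd_nil]
  | cons i l ih =>
    rw [projProd_cons, ← mulVec_mulVec]
    refine (ih _).trans ?_
    rw [projMat_mulVec_dotProduct_self (hA i), sub_le_self_iff]
    exact mul_nonneg (inv_nonneg.2 (real_dotProduct_self_nonneg _)) (sq_nonneg _)

theorem dotProduct_eq_zero_of_projProd_mulVec {m n : ℕ} {A : Matrix (Fin m) (Fin n) ℝ}
    (hA : ∀ i, A i ≠ 0) {l : List (Fin m)} {x : Fin n → ℝ}
    (hx : x ⬝ᵥ x ≤ (projProd A l *ᵥ x) ⬝ᵥ (projProd A l *ᵥ x)) : ∀ i ∈ l, A i ⬝ᵥ x = 0 := by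
  induction l with
  | nil => simp
  | cons i l ih =>
    rw [projProd_cons, ← mulVec_mulVec] at hx
    have hle := hx.trans (projProd_mulVec_dotProduct_self_le hA l _)
    rw [projMat_mulVec_dotProduct_self (hA i)] at hle
    have hpos : 0 < (A i ⬝ᵥ A i)⁻¹ :=
      inv_pos.2 ((real_dotProduct_self_nonneg _).lt_of_ne' (by simpa using hA i))
    have hi : A i ⬝ᵥ x = 0 := by
      by_contra h
      have := mul_pos hpos (pow_pos (abs_pos.2 h) 2)
      rw [sq_abs] at this
      linarith
    rw [projMat_mulVec_of_dotProduct_eq_zero hi] at hx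
    simpa [hi] using ih hx

theorem Qmat_eq_projProd {m n : ℕ} (A : Matrix (Fin m) (Fin n) ℝ) :
    Qmat A = projProd A (List.finRange m) := rfl

theorem one_sub_AS_transpose_mul {m n : ℕ} (A : Matrix (Fin m) (Fin n) ℝ) :
    1 - (AS A)ᵀ * Mdiag A * A = Qmat A := by
  let G : ℕ → Matrix (Fin n) (Fin n) ℝ := fun j => projProd A ((List.finRange m).drop j)
  have hstep (j : Fin m) :
      G (j + 1) - G j = (euclNorm (A j) ^ 2)⁻¹ • vecMulVec (AS A j) (A j) := by
    have hdrop : (List.finRange m).drop j = j :: (List.finRange m).drop (j + 1) := by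
      rw [List.drop_eq_getElem_cons (by simp)]
      simp
    have hG : G j = G (j + 1) * projMat A j := by
      simp only [G, hdrop, projProd_cons]
    rw [hG, projMat, mul_sub, mul_one, sub_sub_cancel, mul_smul_comm, mul_vecMulVec]
    rfl
  have hsum : ∑ j : Fin m, (G (j + 1) - G j) = 1 - Qmat A := by
    rw [Fin.sum_univ_eq_sum_range (fun j => G (j + 1) - G j), Finset.sum_range_sub]
    simp [G, Qmat_eq_projProd, projProd_nil, List.drop_eq_nil_of_le]
  have hprod : (AS A)ᵀ * Mdiag A * A = ∑ j : Fin m, (G (j + 1) - G j) := by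
    ext r s
    rw [mul_apply]
    simp only [hstep, Mdiag, mul_diagonal, transpose_apply, Matrix.sum_apply,
      Matrix.smul_apply, vecMulVec_apply, smul_eq_mul]
    exact Finset.sum_congr rfl fun j _ => by ring
  rw [hprod, hsum, sub_sub_cancel]

/-- A bound on the eigenvalues of `BᵀB` whose eigenvectors are not orthogonal to `e` bounds `B`
at `e`. -/
theorem mulVec_dotProduct_self_le {n : ℕ} (B : Matrix (Fin n) (Fin n) ℝ) (e : Fin n → ℝ) (K : ℝ)
    (h : ∀ (μ : ℝ) (v : Fin n → ℝ), v ≠ 0 → (Bᵀ * B) *ᵥ v = μ • v → v ⬝ᵥ e ≠ 0 → μ ≤ K) :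
    (B *ᵥ e) ⬝ᵥ (B *ᵥ e) ≤ K * (e ⬝ᵥ e) := by
  have hB : (Bᵀ * B).IsHermitian := by
    simpa [conjTranspose_eq_transpose_of_trivial] using isHermitian_conjTranspose_mul_self B
  let u := hB.eigenvectorBasis
  have hparseval (x z : Fin n → ℝ) : x ⬝ᵥ z = ∑ i, (x ⬝ᵥ u i) * (u i ⬝ᵥ z) := by
    have := u.sum_inner_mul_inner (WithLp.toLp 2 x) (WithLp.toLp 2 z)
    simpa [EuclideanSpace.inner_eq_star_dotProduct, dotProduct_comm] using this.symm
  have hu (i : Fin n) : (Bᵀ * B) *ᵥ u i = hB.eigenvalues i • (u i : Fin n → ℝ) :=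
    hB.mulVec_eigenvectorBasis i
  have hBe : (B *ᵥ e) ⬝ᵥ (B *ᵥ e) = ((Bᵀ * B) *ᵥ e) ⬝ᵥ e := by
    rw [← mulVec_mulVec, mulVec_transpose, ← dotProduct_mulVec]
  have hsymm (i : Fin n) : ((Bᵀ * B) *ᵥ e) ⬝ᵥ u i = hB.eigenvalues i * (u i ⬝ᵥ e) := by
    have hT : (Bᵀ * B)ᵀ = Bᵀ * B := by simp
    rw [← vecMul_transpose, hT, ← dotProduct_mulVec, hu, dotProduct_smul, smul_eq_mul,
      dotProduct_comm]
  rw [hBe, hparseval, hparseval e e, Finset.mul_sum]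
  refine Finset.sum_le_sum fun i _ => ?_
  rw [hsymm, dotProduct_comm e, mul_assoc]
  by_cases hi : u i ⬝ᵥ e = 0
  · simp [hi]
  · refine mul_le_mul_of_nonneg_right (h _ (u i) ?_ (hu i) hi) (mul_self_nonneg _)
    intro h0
    exact hi (by simp [h0])

theorem Qmat_mulVec_dotProduct_self_le {m n : ℕ} {A : Matrix (Fin m) (Fin n) ℝ}
    (hA : ∀ i, A i ≠ 0) {e : Fin n → ℝ} (he : ∀ z, A *ᵥ z = 0 → e ⬝ᵥ z = 0) {K : ℝ}
    (hK : ∀ σ, IsSingularValue (Qmat A) σ → σ < 1 → σ ^ 2 ≤ K) :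
    (Qmat A *ᵥ e) ⬝ᵥ (Qmat A *ᵥ e) ≤ K * (e ⬝ᵥ e) := by
  refine mulVec_dotProduct_self_le _ _ _ fun μ v hv hμ hve => ?_
  have hpos : 0 < v ⬝ᵥ v := (real_dotProduct_self_nonneg _).lt_of_ne' (by simpa using hv)
  have hQv : (Qmat A *ᵥ v) ⬝ᵥ (Qmat A *ᵥ v) = μ * (v ⬝ᵥ v) := by
    rw [← smul_eq_mul, ← smul_dotProduct, ← hμ, ← mulVec_mulVec, mulVec_transpose,
      ← dotProduct_mulVec]
  have hμ0 : 0 ≤ μ := nonneg_of_mul_nonneg_left (hQv ▸ real_dotProduct_self_nonneg _) hpos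
  have hμ1 : μ < 1 := by
    by_contra! h
    refine hve ?_
    rw [dotProduct_comm]
    refine he v (funext fun i => ?_)
    refine dotProduct_eq_zero_of_projProd_mulVec hA (l := List.finRange m) ?_ i
      (List.mem_finRange i)
    rw [← Qmat_eq_projProd, hQv]
    exact le_mul_of_one_le_left hpos.le h
  rw [← Real.sq_sqrt hμ0]
  refine hK _ ⟨Real.sqrt_nonneg _, v, hv, ?_⟩ ?_
  · rw [Real.sq_sqrt hμ0, hμ]
  · rw [Real.sqrt_lt' one_pos]
    simpa using hμ1

/-- with `𝒦 = 1 − min({1 − σ² : σ singular value of Q, σ < 1} ∪ {1})`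
and `e_k = y_k − P_{N(A)}y₀ − x†`, one has `‖e_{k+1}‖₂² ≤ 𝒦‖e_k‖₂²` and
`‖e_{k+1}‖₂² ≤ 𝒦^{k+1}‖e₀‖₂²`. -/
theorem stmt14 {m n : ℕ} (A : Matrix (Fin m) (Fin n) ℝ) (hA : ∀ i, A i ≠ 0)
    (b : Fin m → ℝ) (xd : Fin n → ℝ) (hxd1 : A.mulVec xd = b)
    (hxd2 : ∀ z : Fin n → ℝ, A.mulVec z = 0 → xd ⬝ᵥ z = 0)
    (y : ℕ → Fin n → ℝ)
    (hy : ∀ k, y (k + 1) =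
      ((1 : Matrix (Fin n) (Fin n) ℝ) - (AS A)ᵀ * Mdiag A * A).mulVec (y k) +
        (AS A)ᵀ.mulVec ((Mdiag A).mulVec b))
    (Py0 : Fin n → ℝ) (hPy0a : A.mulVec Py0 = 0)
    (hPy0b : ∀ z : Fin n → ℝ, A.mulVec z = 0 → (y 0 - Py0) ⬝ᵥ z = 0)
    (K : ℝ)
    (hK : K = 1 - sInf ({t : ℝ | ∃ σ : ℝ, IsSingularValue (Qmat A) σ ∧ σ < 1 ∧ t = 1 - σ ^ 2} ∪ {1})) :
    ∀ k : ℕ,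
      euclNorm (y (k + 1) - Py0 - xd) ^ 2 ≤ K * euclNorm (y k - Py0 - xd) ^ 2 ∧
      euclNorm (y (k + 1) - Py0 - xd) ^ 2 ≤ K ^ (k + 1) * euclNorm (y 0 - Py0 - xd) ^ 2 := by
  have hbdd : BddBelow ({t : ℝ | ∃ σ : ℝ, IsSingularValue (Qmat A) σ ∧ σ < 1 ∧ t = 1 - σ ^ 2} ∪
      {1}) := by
    refine ⟨0, ?_⟩
    rintro t (⟨σ, hσ, h1, rfl⟩ | rfl)
    · exact sub_nonneg.2 (pow_le_one₀ hσ.1 h1.le)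
    · exact zero_le_one
  have hK0 : 0 ≤ K := by
    rw [hK, sub_nonneg]
    exact csInf_le hbdd (Or.inr rfl)
  have hKσ : ∀ σ, IsSingularValue (Qmat A) σ → σ < 1 → σ ^ 2 ≤ K := fun σ hσ h1 => by
    have := csInf_le hbdd (Or.inl ⟨σ, hσ, h1, rfl⟩)
    linarith
  have hQ := one_sub_AS_transpose_mul A
  have hrec (k : ℕ) : y (k + 1) - Py0 - xd = Qmat A *ᵥ (y k - Py0 - xd) := by
    rw [hy, ← hQ, ← hxd1]
    simp only [sub_mulVec, mulVec_sub, one_mulVec, ← mulVec_mulVec, hPy0a, mulVec_zero]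
    abel
  have horth (k : ℕ) : ∀ z, A *ᵥ z = 0 → (y k - Py0 - xd) ⬝ᵥ z = 0 := by
    induction k with
    | zero => exact fun z hz => by rw [sub_dotProduct, hPy0b z hz, hxd2 z hz, sub_zero]
    | succ k ih =>
      intro z hz
      rw [hrec, Qmat_eq_projProd, projProd_mulVec_dotProduct (congrFun hz), ih z hz]
  have hstep (k : ℕ) :
      euclNorm (y (k + 1) - Py0 - xd) ^ 2 ≤ K * euclNorm (y k - Py0 - xd) ^ 2 := by
    rw [euclNorm_sq, euclNorm_sq, hrec]
    exact Qmat_mulVec_dotProduct_self_le hA (horth k) hKσ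
  refine fun k => ⟨hstep k, ?_⟩
  induction k with
  | zero => simpa using hstep 0
  | succ k ih =>
    refine (hstep (k + 1)).trans ((mul_le_mul_of_nonneg_left ih hK0).trans_eq ?_)
    ring

end
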